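/- arXiv:1703.01215 — 2 statements merged into one kernel-verified Lean document; each statement's English description precedes it below -/
import Mathlib

section
/- Let p be an odd prime and α, β ∈ ℤ_p. Assume 2⟨−β⟩_p < p, (2β)_{p−1} ≢ 0 (mod p²), and ⟨−α⟩_p is odd. Then ∑_{k=0}^{p−1} (α)_k(1−α)_k(β)_k/((k!)²(2β)_k) ≡ 0 (mod p²), i.e. the truncated series ₃F₂[α, 1−α, β; 1, 2β | 1]_{p−1} has p-adic norm at most p^{−2}. (This is the vanishing case of the p-adic analogue of Watson's ₃F₂ identity.) -/
open scoped BigOperators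

/-- The Pochhammer symbol `(x)_k = x(x+1)⋯(x+k-1)` in `ℚ_[p]`. -/
noncomputable def poch (p : ℕ) [Fact p.Prime] (x : ℚ_[p]) (k : ℕ) : ℚ_[p] :=
  (ascPochhammer ℚ_[p] k).eval x

/-- The least non-negative residue `⟨α⟩_p ∈ {0,…,p-1}` of `α ∈ ℤ_[p]` modulo `p`. -/
noncomputable def res (p : ℕ) [Fact p.Prime] (α : ℤ_[p]) : ℕ :=
  (PadicInt.toZMod α).val

section Watson

open Polynomial

variable {K : Type*} [Field K]

/-- The linear functional on polynomials with moments `X ^ k ↦ (b)_k / (2b)_k`. -/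
noncomputable def betaMoment (b : K) : K[X] →ₗ[K] K :=
  Polynomial.lsum fun k =>
    ((ascPochhammer K k).eval b / (ascPochhammer K k).eval (2 * b)) • LinearMap.id

theorem betaMoment_X_pow (b : K) (k : ℕ) :
    betaMoment b (X ^ k) =
      (ascPochhammer K k).eval b / (ascPochhammer K k).eval (2 * b) := by
  rw [betaMoment, lsum_apply, ← monomial_one_right_eq_X_pow, sum_monomial_index]
  · simp
  · simp

theorem ascPochhammer_eval_ne_zero_of_le {x : K} {k n : ℕ} (hkn : k ≤ n)
    (h : (ascPochhammer K n).eval x ≠ 0) : (ascPochhammer K k).eval x ≠ 0 := by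
  rw [ne_eq, ascPochhammer_eval_eq_zero_iff] at h ⊢
  rintro ⟨i, hi, h'⟩
  exact h ⟨i, hi.trans_le hkn, h'⟩

theorem betaMoment_X_pow_mul_one_sub_X_pow (b : K) {n : ℕ}
    (hn : (ascPochhammer K n).eval (2 * b) ≠ 0) (j i : ℕ) (hij : i + j ≤ n) :
    betaMoment b (X ^ i * (1 - X) ^ j) =
      (ascPochhammer K i).eval b * (ascPochhammer K j).eval b /
        (ascPochhammer K (i + j)).eval (2 * b) := by
  induction j generalizing i with
  | zero => simp [betaMoment_X_pow]
  | succ j ih =>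
    have hsplit : (X ^ i * (1 - X) ^ (j + 1) : K[X]) =
        X ^ i * (1 - X) ^ j - X ^ (i + 1) * (1 - X) ^ j := by ring
    have hne := ascPochhammer_eval_ne_zero_of_le hij hn
    rw [hsplit, map_sub, ih i (by omega), ih (i + 1) (by omega),
      show i + 1 + j = i + j + 1 by ring, ← add_assoc]
    rw [← add_assoc, ascPochhammer_succ_eval] at hne
    obtain ⟨h1, h2⟩ := mul_ne_zero_iff.1 hne
    simp only [ascPochhammer_succ_eval]
    push_cast at h2 ⊢
    field_simp
    ring

theorem betaMoment_comp_one_sub_X (b : K) {n : ℕ}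
    (hn : (ascPochhammer K n).eval (2 * b) ≠ 0) (q : K[X]) (hq : q.natDegree ≤ n) :
    betaMoment b (q.comp (1 - X)) = betaMoment b q := by
  rw [q.as_sum_range_C_mul_X_pow, Polynomial.sum_comp, map_sum, map_sum]
  refine Finset.sum_congr rfl fun k hk => ?_
  rw [mul_comp, C_comp, X_pow_comp, C_mul', C_mul', map_smul, map_smul, betaMoment_X_pow]
  have := betaMoment_X_pow_mul_one_sub_X_pow b hn k 0
    (by have := Finset.mem_range.1 hk; omega)
  simpa using congrArg (q.coeff k • ·) this

theorem betaMoment_shiftedLegendre_eq_zero [CharZero K] (b : K) {n : ℕ} (hodd : Odd n)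
    (hn : (ascPochhammer K n).eval (2 * b) ≠ 0) :
    betaMoment b ((shiftedLegendre n).map (Int.castRingHom K)) = 0 := by
  set q := (shiftedLegendre n).map (Int.castRingHom K) with hqdef
  have hsymm : q.comp (1 - X) = -q := by
    have h := congrArg (Polynomial.map (Int.castRingHom K))
      (neg_one_pow_mul_shiftedLegendre_comp_one_sub_X_eq n)
    rw [hodd.neg_one_pow] at h
    simp only [neg_mul, one_mul, Polynomial.map_neg, Polynomial.map_comp, Polynomial.map_sub,
      Polynomial.map_one, Polynomial.map_X] at h
    rw [← hqdef] at h
    rw [← h, neg_neg, h]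
  have hdeg : q.natDegree ≤ n := natDegree_map_le.trans (natDegree_shiftedLegendre n).le
  have h := betaMoment_comp_one_sub_X b hn q hdeg
  rw [hsymm, map_neg] at h
  exact self_eq_neg.1 h.symm

theorem ascPochhammer_eval_neg_mul_eval_succ (n k : ℕ) :
    (ascPochhammer K k).eval (-(n : K)) * (ascPochhammer K k).eval ((n : K) + 1) =
      (k.factorial : K) ^ 2 * ((-1) ^ k * n.choose k * (n + k).choose n) := by
  rw [ascPochhammer_eval_neg_eq_descPochhammer, descPochhammer_eval_eq_descFactorial,
    ← Nat.cast_succ, ascPochhammer_nat_eq_natCast_ascFactorial,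
    Nat.descFactorial_eq_factorial_mul_choose, Nat.ascFactorial_eq_factorial_mul_choose,
    Nat.choose_symm_add]
  push_cast
  ring

/-- The vanishing case of Watson's identity for a terminating series. -/
theorem watson_terminating_eq_zero [CharZero K] (b : K) {n N : ℕ} (hodd : Odd n) (hnN : n < N)
    (hn : (ascPochhammer K n).eval (2 * b) ≠ 0) :
    ∑ k ∈ Finset.range N,
      (ascPochhammer K k).eval (-(n : K)) * (ascPochhammer K k).eval ((n : K) + 1) *
        (ascPochhammer K k).eval b /
          ((k.factorial : K) ^ 2 * (ascPochhammer K k).eval (2 * b)) = 0 := by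
  rw [← betaMoment_shiftedLegendre_eq_zero b hodd hn]
  have hdeg : ((shiftedLegendre n).map (Int.castRingHom K)).natDegree < N :=
    (natDegree_map_le.trans (natDegree_shiftedLegendre n).le).trans_lt hnN
  rw [betaMoment, lsum_apply, sum_over_range' _ (by simp) N hdeg]
  refine Finset.sum_congr rfl fun k _ => ?_
  have hk : (k.factorial : K) ≠ 0 := Nat.cast_ne_zero.2 k.factorial_ne_zero
  rw [ascPochhammer_eval_neg_mul_eval_succ, coeff_map, coeff_shiftedLegendre]
  simp only [LinearMap.smul_apply, LinearMap.id_apply, smul_eq_mul, eq_intCast]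
  push_cast
  rw [mul_assoc, mul_div_mul_left _ _ (pow_ne_zero 2 hk)]
  ring

end Watson

section Interpolation

open Polynomial

/-- Modulo `r ^ 2`, a polynomial is affine along the progression `x + r s`. -/
theorem sq_dvd_eval_add_mul_of_eval_eq_zero {R : Type*} [CommRing R] (f : R[X]) {x r : R} (s : R)
    (h0 : f.eval x = 0) (h1 : f.eval (x + r) = 0) : r ^ 2 ∣ f.eval (x + r * s) := by
  obtain ⟨u, hu⟩ := f.binomExpansion x r
  obtain ⟨v, hv⟩ := f.binomExpansion x (r * s)
  rw [h0] at hu hv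
  rw [h1] at hu
  exact ⟨v * s ^ 2 - u * s, by linear_combination hv - s * hu⟩

end Interpolation

section Padic

open Polynomial

variable {p : ℕ} [Fact p.Prime]

theorem poch_coe (x : ℤ_[p]) (k : ℕ) :
    poch p (x : ℚ_[p]) k = ((ascPochhammer ℤ_[p] k).eval x : ℤ_[p]) := by
  rw [poch, ascPochhammer_eval₂ (PadicInt.Coe.ringHom (p := p))]
  exact eval₂_at_apply (PadicInt.Coe.ringHom (p := p)) x

theorem natCast_res (x : ℤ_[p]) : (res p x : ZMod p) = PadicInt.toZMod x := by
  rw [res, ZMod.natCast_val, ZMod.cast_id', id]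

theorem dvd_iff_toZMod_eq_zero (x : ℤ_[p]) : (p : ℤ_[p]) ∣ x ↔ PadicInt.toZMod x = 0 := by
  rw [← RingHom.mem_ker, PadicInt.ker_toZMod, PadicInt.maximalIdeal_eq_span_p,
    Ideal.mem_span_singleton]

theorem dvd_add_res_neg (x : ℤ_[p]) : (p : ℤ_[p]) ∣ x + res p (-x) := by
  rw [dvd_iff_toZMod_eq_zero]
  simp [natCast_res]

theorem dvd_ascPochhammer_eval_iff (x : ℤ_[p]) (k : ℕ) :
    (p : ℤ_[p]) ∣ (ascPochhammer ℤ_[p] k).eval x ↔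
      ∃ i < k, (i : ZMod p) = -PadicInt.toZMod x := by
  rw [dvd_iff_toZMod_eq_zero, ← eval₂_at_apply, ← ascPochhammer_eval₂,
    ascPochhammer_eval_eq_zero_iff]

theorem norm_poch_div_poch_two_mul_le_one (β : ℤ_[p]) (hb : 2 * res p (-β) < p)
    (h2b : ¬ ((p : ℤ_[p]) ^ 2 ∣ (ascPochhammer ℤ_[p] (p - 1)).eval (2 * β)))
    {k : ℕ} (hk : k < p) :
    ‖poch p (β : ℚ_[p]) k / poch p (2 * (β : ℚ_[p])) k‖ ≤ 1 := by
  have h2 : (2 * (β : ℚ_[p])) = ((2 * β : ℤ_[p]) : ℚ_[p]) := by push_cast; rfl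
  rw [h2, poch_coe, poch_coe]
  set B := (ascPochhammer ℤ_[p] k).eval β
  set D := (ascPochhammer ℤ_[p] k).eval (2 * β)
  suffices h : D ∣ B by
    obtain ⟨c, hc⟩ := h
    rw [hc]
    by_cases h0 : (D : ℚ_[p]) = 0
    · simp [h0]
    · push_cast
      rw [mul_div_cancel_left₀ _ h0]
      exact c.norm_le_one
  by_cases hpD : (p : ℤ_[p]) ∣ D
  · obtain ⟨d, hd⟩ := hpD
    have hDdvd : D ∣ (ascPochhammer ℤ_[p] (p - 1)).eval (2 * β) := by
      rw [show p - 1 = k + (p - 1 - k) by omega, ← ascPochhammer_mul, eval_mul]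
      exact dvd_mul_right _ _
    have hdu : IsUnit d := by
      by_contra hdu
      have hpd : (p : ℤ_[p]) ∣ d := by
        rwa [← PadicInt.norm_lt_one_iff_dvd, ← PadicInt.mem_nonunits]
      refine h2b (dvd_trans ?_ hDdvd)
      rw [hd, sq]
      exact mul_dvd_mul_left _ hpd
    rw [hd, hdu.mul_right_dvd]
    obtain ⟨i, hik, hi⟩ := (dvd_ascPochhammer_eval_iff _ _).1 (Dvd.intro d hd.symm)
    refine (dvd_ascPochhammer_eval_iff _ _).2 ⟨res p (-β), ?_, by simp [natCast_res]⟩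
    have hi' : (i : ZMod p) = ((2 * res p (-β) : ℕ) : ZMod p) := by
      rw [hi, Nat.cast_mul, natCast_res, map_mul, map_neg, map_ofNat]
      push_cast
      ring
    rw [ZMod.natCast_eq_natCast_iff', Nat.mod_eq_of_lt (hik.trans hk), Nat.mod_eq_of_lt hb] at hi'
    omega
  · have hu : IsUnit D := by
      by_contra hu
      exact hpD (by rwa [← PadicInt.norm_lt_one_iff_dvd, ← PadicInt.mem_nonunits])
    exact hu.dvd

theorem norm_factorial_eq_one {k : ℕ} (hk : k < p) : ‖(k.factorial : ℚ_[p])‖ = 1 := by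
  rw [Padic.norm_natCast_eq_one_iff]
  exact (Fact.out : p.Prime).coprime_factorial_of_lt hk

end Padic

/-- Vanishing case of the p-adic analogue of Watson's `₃F₂` identity:
if `⟨−α⟩_p` is odd then `₃F₂[α,1−α,β;1,2β|1]_{p−1} ≡ 0 (mod p²)`. -/
theorem padic_watson_vanishing
    (p : ℕ) [Fact p.Prime] (hp : Odd p) (α β : ℤ_[p])
    (hb : 2 * res p (-β) < p)
    (h2b : ¬ ((p : ℤ_[p]) ^ 2 ∣ (ascPochhammer ℤ_[p] (p - 1)).eval (2 * β)))
    (ha : Odd (res p (-α))) :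
    ‖∑ k ∈ Finset.range p,
        poch p (α : ℚ_[p]) k * poch p (1 - (α : ℚ_[p])) k * poch p (β : ℚ_[p]) k
          / ((Nat.factorial k : ℚ_[p]) ^ 2 * poch p (2 * (β : ℚ_[p])) k)‖
      ≤ (p : ℝ) ^ (-2 : ℤ) := by
  obtain ⟨s, hs⟩ := dvd_add_res_neg α
  set a := res p (-α)
  have hap : a < p := ZMod.val_lt _
  have hpc : ∀ k, ∃ c : ℤ_[p], k < p → (c : ℚ_[p]) =
      poch p (β : ℚ_[p]) k / ((Nat.factorial k : ℚ_[p]) ^ 2 * poch p (2 * (β : ℚ_[p])) k) := by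
    intro k
    by_cases hk : k < p
    · refine ⟨⟨_, ?_⟩, fun _ => rfl⟩
      rw [mul_comm, ← div_div, norm_div, norm_pow, norm_factorial_eq_one hk, one_pow, div_one]
      exact norm_poch_div_poch_two_mul_le_one β hb h2b hk
    · exact ⟨0, fun h => absurd h hk⟩
  choose c hc using hpc
  let f : Polynomial ℤ_[p] := ∑ k ∈ Finset.range p,
    Polynomial.C (c k) * (ascPochhammer ℤ_[p] k * (ascPochhammer ℤ_[p] k).comp (1 - Polynomial.X))
  have hf : ∀ x : ℤ_[p], ((f.eval x : ℤ_[p]) : ℚ_[p]) = ∑ k ∈ Finset.range p,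
      poch p (x : ℚ_[p]) k * poch p (1 - (x : ℚ_[p])) k * poch p (β : ℚ_[p]) k
        / ((Nat.factorial k : ℚ_[p]) ^ 2 * poch p (2 * (β : ℚ_[p])) k) := by
    intro x
    have h1 : (1 - (x : ℚ_[p])) = ((1 - x : ℤ_[p]) : ℚ_[p]) := by push_cast; rfl
    rw [h1, Polynomial.eval_finsetSum, PadicInt.coe_sum]
    refine Finset.sum_congr rfl fun k hk => ?_
    rw [Polynomial.eval_mul, Polynomial.eval_C, Polynomial.eval_mul, Polynomial.eval_comp, PadicInt.coe_mul, PadicInt.coe_mul,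
      hc k (Finset.mem_range.1 hk), poch_coe x, poch_coe (1 - x)]
    simp only [Polynomial.eval_sub, Polynomial.eval_one, Polynomial.eval_X]
    ring
  have h2 : (2 * (β : ℚ_[p])) = ((2 * β : ℤ_[p]) : ℚ_[p]) := by push_cast; rfl
  have hne : (ascPochhammer ℚ_[p] (p - 1)).eval (2 * (β : ℚ_[p])) ≠ 0 := by
    intro h
    have h' := poch_coe (2 * β) (p - 1)
    rw [poch, ← h2, h] at h'
    rw [PadicInt.coe_eq_zero.1 h'.symm] at h2b
    exact h2b (dvd_zero _)
  have hvanish : ∀ n : ℕ, Odd n → n < p → ∀ x : ℤ_[p], (x = -n ∨ 1 - x = -n) → f.eval x = 0 := by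
    intro n hodd hn x hx
    rw [← PadicInt.coe_eq_zero, hf,
      ← watson_terminating_eq_zero (β : ℚ_[p]) hodd hn
        (ascPochhammer_eval_ne_zero_of_le (by omega) hne)]
    refine Finset.sum_congr rfl fun k _ => ?_
    rcases hx with hx | hx
    · rw [hx]
      simp only [poch, PadicInt.coe_neg, PadicInt.coe_natCast, sub_neg_eq_add, add_comm (1 : ℚ_[p])]
    · obtain rfl : x = n + 1 := by linear_combination -hx
      simp only [poch, PadicInt.coe_add, PadicInt.coe_natCast, PadicInt.coe_one, sub_add_cancel_right]
      ring
  have h0 : f.eval (-(a : ℤ_[p])) = 0 := hvanish a ha hap _ (Or.inl rfl)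
  have h1 : f.eval (-(a : ℤ_[p]) + p) = 0 := by
    refine hvanish (p - 1 - a) ?_ (by omega) _ (Or.inr ?_)
    · have := hp.pos
      grind
    · rw [Nat.sub_sub, Nat.cast_sub (by omega)]
      push_cast
      ring
  have hdvd := sq_dvd_eval_add_mul_of_eval_eq_zero f s h0 h1
  rw [show -(a : ℤ_[p]) + p * s = α by linear_combination -hs] at hdvd
  rw [← hf α, ← PadicInt.norm_def]
  exact (PadicInt.norm_le_pow_iff_mem_span_pow _ 2).2 (Ideal.mem_span_singleton.2 hdvd)
end

section
/- Let p be an odd prime and α, β, γ, δ, ε ∈ ℤ_p with α ≠ 0. Assume: (i) ⟨−α⟩_p ≤ min{⟨−β⟩_p, ⟨−γ⟩_p, ⟨−δ⟩_p, ⟨−ε⟩_p}; (ii) p + ⟨−α⟩_p > max{⟨−β⟩_p+⟨−γ⟩_p, ⟨−β⟩_p+⟨−δ⟩_p, ⟨−β⟩_p+⟨−ε⟩_p, ⟨−γ⟩_p+⟨−δ⟩_p}; (iii) 2p − 1 + ⟨−α⟩_p ≤ ⟨−β⟩_p + ⟨−γ⟩_p + ⟨−δ⟩_p + ⟨−ε⟩_p;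 (iv) none of (α−β+1)_{p−1}, (α−γ+1)_{p−1}, (α−δ+1)_{p−1}, (α−ε+1)_{p−1} is divisible by p². Then ∑_{k=0}^{p−1} ((α+2k)/α) · (α)_k²(β)_k(γ)_k(δ)_k(ε)_k / ((k!)²(α−β+1)_k(α−γ+1)_k(α−δ+1)_k(α−ε+1)_k) ≡ 0 (mod p²). (Since (1+α/2)_k/(α/2)_k = (α+2k)/α, this sum is the truncated very-well-poised series ₇F₆[α, α, 1+α/2, β, γ, δ, ε; 1, α/2, α−β+1, α−γ+1, α−δ+1, α−ε+1 | 1]_{p−1}.) -/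
open scoped BigOperators

namespace VeryWellPoised

open Finset

/-- The rising factorial `x (x + 1) ⋯ (x + k - 1)`, as a product. -/
def rising {R : Type*} [CommRing R] (x : R) (k : ℕ) : R := ∏ i ∈ range k, (x + i)

section CommRing

variable {R : Type*} [CommRing R]

@[simp] lemma rising_zero (x : R) : rising x 0 = 1 := by simp [rising]

lemma rising_succ (x : R) (k : ℕ) : rising x (k + 1) = rising x k * (x + k) := by
  simp [rising, prod_range_succ]

lemma rising_add (x : R) (m n : ℕ) : rising x (m + n) = rising x m * rising (x + m) n := by
  simp [rising, prod_range_add, add_assoc]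

lemma rising_succ_left (x : R) (k : ℕ) : rising x (k + 1) = x * rising (x + 1) k := by
  rw [add_comm k 1, rising_add]
  simp [rising]

lemma eval_ascPochhammer_eq_rising (x : R) (k : ℕ) :
    (ascPochhammer R k).eval x = rising x k := by
  induction k with
  | zero => simp
  | succ k ih => rw [ascPochhammer_succ_eval, ih, rising_succ]

lemma rising_one_eq_factorial (k : ℕ) :
    rising (1 : R) k = (k.factorial : R) := by
  induction k with
  | zero => simp
  | succ k ih => rw [rising_succ, ih, Nat.factorial_succ]; push_cast; ring

lemma rising_reflect (x : R) (k : ℕ) : rising (1 - k - x) k = (-1) ^ k * rising x k := by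
  induction k generalizing x with
  | zero => simp
  | succ k ih =>
    rw [rising_succ_left, rising_succ,
      show (1 - ((k + 1 : ℕ) : R) - x + 1) = 1 - k - x by push_cast; ring, ih]
    push_cast
    ring

lemma rising_neg_natCast_eq_zero {n k : ℕ} (h : n < k) : rising (-(n : R)) k = 0 :=
  prod_eq_zero (mem_range.2 h) (by simp)

lemma rising_neg_natCast_mul_factorial (i j : ℕ) :
    rising (-((j + i : ℕ) : R)) j * (i.factorial : R) = (-1) ^ j * ((j + i).factorial : R) := by
  induction j with
  | zero => simp
  | succ j ih =>
    rw [rising_succ_left, show (-((j + 1 + i : ℕ) : R) + 1) = -((j + i : ℕ) : R) by push_cast; ring,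
      mul_assoc, ih, show j + 1 + i = (j + i) + 1 by ring, Nat.factorial_succ]
    push_cast
    ring

lemma rising_neg_natCast_eq_choose {n k : ℕ} (h : k ≤ n) :
    rising (-(n : R)) k = (-1) ^ k * (n.choose k : R) * (k.factorial : R) := by
  induction k with
  | zero => simp
  | succ k ih =>
    have h2 := Nat.choose_succ_right_eq n k
    have h3 : ((n.choose (k + 1) : R)) * (k + 1) = n.choose k * ((n : R) - k) := by
      rw [← Nat.cast_sub (by omega)]
      exact_mod_cast congrArg (Nat.cast (R := R)) h2
    rw [rising_succ, ih (by omega), Nat.factorial_succ]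
    push_cast
    linear_combination (-1) ^ k * (k.factorial : R) * h3

end CommRing

section Field

variable {K : Type*} [Field K]

lemma rising_ne_zero {x : K} {k : ℕ} (h : ∀ i < k, x + i ≠ 0) : rising x k ≠ 0 :=
  prod_ne_zero_iff.2 fun i hi => h i (mem_range.1 hi)

variable [CharZero K]

lemma saalschutz_telescope (a u v : K) (n m : ℕ)
    (hu : ∀ i < m, u + i ≠ 0) (hv : ∀ i < m, v + i ≠ 0) :
    ∑ j ∈ range (m + 1), rising (u + v - 1 - a) j / (j.factorial * rising u j * rising v j) *
        ((u + n) * (v + n) * (rising (-((n + 1 : ℕ) : K)) j * rising (a + (n + 1 : ℕ)) j) -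
          (1 + a - u + n) * (1 + a - v + n) * (rising (-(n : K)) j * rising (a + n) j)) =
      (a + 2 * n + 1) * (rising (-(n : K)) m * rising (a + n + 1) m * rising (u + v - 1 - a) (m + 1))
        / (m.factorial * rising u m * rising v m) := by
  induction m with
  | zero =>
    simp [rising_succ]
    ring
  | succ m ih =>
    rw [sum_range_succ, ih (fun i hi => hu i (by omega)) (fun i hi => hv i (by omega))]
    have h1 : rising u m ≠ 0 := rising_ne_zero fun i hi => hu i (by omega)
    have h2 : rising v m ≠ 0 := rising_ne_zero fun i hi => hv i (by omega)
    have h3 := hu m (by omega)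
    have h4 := hv m (by omega)
    have h5 : (m.factorial : K) ≠ 0 := by exact_mod_cast m.factorial_ne_zero
    have h6 : (m : K) + 1 ≠ 0 := by exact_mod_cast m.succ_ne_zero
    rw [rising_succ_left (-((n + 1 : ℕ) : K)) m, rising_succ_left (a + n) m,
      show (-((n + 1 : ℕ) : K)) + 1 = -(n : K) by push_cast; ring,
      show a + ((n + 1 : ℕ) : K) = a + n + 1 by push_cast; ring]
    simp only [rising_succ, Nat.factorial_succ]
    push_cast
    field_simp
    ring

/-- The **Pfaff–Saalschütz** summation, in the well-poised normalisation. -/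
lemma saalschutz (a u v : K) (n : ℕ)
    (hu : ∀ i < n, u + i ≠ 0) (hv : ∀ i < n, v + i ≠ 0) :
    ∑ j ∈ range (n + 1), rising (u + v - 1 - a) j / (j.factorial * rising u j * rising v j) *
        (rising (-(n : K)) j * rising (a + n) j) =
      rising (1 + a - u) n * rising (1 + a - v) n / (rising u n * rising v n) := by
  induction n with
  | zero => simp
  | succ n ih =>
    have ih := ih (fun i hi => hu i (by omega)) (fun i hi => hv i (by omega))
    have key := saalschutz_telescope a u v n (n + 1) hu hv
    rw [rising_neg_natCast_eq_zero (Nat.lt_succ_self n)] at key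
    simp only [mul_sub, sum_sub_distrib] at key
    have e : ∑ j ∈ range (n + 1 + 1),
        rising (u + v - 1 - a) j / (j.factorial * rising u j * rising v j) *
          ((1 + a - u + n) * (1 + a - v + n) * (rising (-(n : K)) j * rising (a + n) j)) =
        (1 + a - u + n) * (1 + a - v + n) *
          (rising (1 + a - u) n * rising (1 + a - v) n / (rising u n * rising v n)) := by
      rw [sum_range_succ, rising_neg_natCast_eq_zero (Nat.lt_succ_self n), ← ih, mul_sum]
      simp only [zero_mul, mul_zero, add_zero]
      exact sum_congr rfl fun j _ => by ring
    have e' : ∑ j ∈ range (n + 1 + 1),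
        rising (u + v - 1 - a) j / (j.factorial * rising u j * rising v j) *
          ((u + n) * (v + n) * (rising (-((n + 1 : ℕ) : K)) j * rising (a + (n + 1 : ℕ)) j)) =
        (u + n) * (v + n) * ∑ j ∈ range (n + 1 + 1),
        rising (u + v - 1 - a) j / (j.factorial * rising u j * rising v j) *
          (rising (-((n + 1 : ℕ) : K)) j * rising (a + (n + 1 : ℕ)) j) := by
      rw [mul_sum]
      exact sum_congr rfl fun j _ => by ring
    rw [e, e'] at key
    have h1 : rising u n ≠ 0 := rising_ne_zero fun i hi => hu i (by omega)
    have h2 : rising v n ≠ 0 := rising_ne_zero fun i hi => hv i (by omega)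
    have h3 := hu n (by omega)
    have h4 := hv n (by omega)
    apply mul_left_cancel₀ (mul_ne_zero h3 h4)
    rw [sub_eq_iff_eq_add.1 key]
    simp only [rising_succ]
    field_simp
    ring

lemma wellPoised_telescope (a u v : K) (n m : ℕ)
    (hu : ∀ i < m, u + i ≠ 0) (hv : ∀ i < m, v + i ≠ 0)
    (ha : ∀ i < m + 1, a + n + 1 + i ≠ 0) :
    ∑ i ∈ range (m + 1), (a + 2 * i) * rising a i * rising (1 + a - u) i * rising (1 + a - v) i
          / (i.factorial * rising u i * rising v i) *
        ((u + n) * (v + n) * (rising (-((n + 1 : ℕ) : K)) i / rising (1 + a + (n + 1 : ℕ)) i) -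
          (a + n + 1) * (u + v - 1 - a + n) * (rising (-(n : K)) i / rising (1 + a + n) i)) =
      rising a (m + 1) * rising (1 + a - u) (m + 1) * rising (1 + a - v) (m + 1) *
        rising (-(n : K)) m / (m.factorial * rising u m * rising v m * rising (2 + a + n) m) := by
  induction m with
  | zero =>
    simp [rising_succ]
    ring
  | succ m ih =>
    rw [sum_range_succ, ih (fun i hi => hu i (by omega)) (fun i hi => hv i (by omega))
      (fun i hi => ha i (by omega))]
    have h1 : rising u m ≠ 0 := rising_ne_zero fun i hi => hu i (by omega)
    have h2 : rising v m ≠ 0 := rising_ne_zero fun i hi => hv i (by omega)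
    have h3 := hu m (by omega)
    have h4 := hv m (by omega)
    have h5 : (m.factorial : K) ≠ 0 := by exact_mod_cast m.factorial_ne_zero
    have h6 : (m : K) + 1 ≠ 0 := by exact_mod_cast m.succ_ne_zero
    have h7 : rising (2 + a + n) m ≠ 0 := rising_ne_zero fun i hi => by
      convert ha (i + 1) (by omega) using 1
      push_cast
      ring
    have h8 : 2 + a + n + m ≠ 0 := by
      convert ha (m + 1) (by omega) using 1
      push_cast
      ring
    have h9 : 1 + a + n ≠ 0 := by
      convert ha 0 (by omega) using 1
      push_cast
      ring
    rw [rising_succ_left (-((n + 1 : ℕ) : K)) m,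
      show (-((n + 1 : ℕ) : K)) + 1 = -(n : K) by push_cast; ring,
      show 1 + a + ((n + 1 : ℕ) : K) = 2 + a + n by push_cast; ring,
      rising_succ_left (1 + a + n) m, show 1 + a + (n : K) + 1 = 2 + a + n by ring]
    simp only [rising_succ, Nat.factorial_succ]
    push_cast
    field_simp
    ring

/-- The terminating very-well-poised `₅F₄` summation. -/
lemma wellPoised_sum (a u v : K) (n : ℕ)
    (hu : ∀ i < n, u + i ≠ 0) (hv : ∀ i < n, v + i ≠ 0)
    (ha : ∀ i < 2 * n, a + 1 + i ≠ 0) :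
    ∑ i ∈ range (n + 1), (a + 2 * i) * rising a i * rising (1 + a - u) i * rising (1 + a - v) i
          / (i.factorial * rising u i * rising v i) *
        (rising (-(n : K)) i / rising (1 + a + n) i) =
      rising a (n + 1) * rising (u + v - 1 - a) n / (rising u n * rising v n) := by
  induction n with
  | zero => simp [rising_succ]
  | succ n ih =>
    have ih := ih (fun i hi => hu i (by omega)) (fun i hi => hv i (by omega))
      (fun i hi => ha i (by omega))
    have key := wellPoised_telescope a u v n (n + 1) hu hv (fun i hi => by
      convert ha (n + i) (by omega) using 1
      push_cast
      ring)
    rw [rising_neg_natCast_eq_zero (Nat.lt_succ_self n)] at key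
    simp only [mul_sub, sum_sub_distrib, mul_left_comm _ ((u + n) * (v + n)),
      mul_left_comm _ ((a + n + 1) * (u + v - 1 - a + n)), ← mul_sum] at key
    rw [sum_range_succ _ (n + 1), sum_range_succ _ (n + 1),
      rising_neg_natCast_eq_zero (Nat.lt_succ_self n), ih, zero_div, mul_zero, mul_zero,
      zero_div, add_zero, ← sum_range_succ] at key
    have h1 : rising u n ≠ 0 := rising_ne_zero fun i hi => hu i (by omega)
    have h2 : rising v n ≠ 0 := rising_ne_zero fun i hi => hv i (by omega)
    have h3 := hu n (by omega)
    have h4 := hv n (by omega)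
    apply mul_left_cancel₀ (mul_ne_zero h3 h4)
    rw [sub_eq_iff_eq_add.1 key, rising_succ a (n + 1)]
    simp only [rising_succ _ n]
    push_cast
    field_simp
    ring


/-- The `k`-th term of the very-well-poised `₇F₆` series with base `a`, multiplied by `a`. -/
def wellPoisedTerm (a b c d e f : K) (k : ℕ) : K :=
  (a + 2 * k) * rising a k * rising f k * (rising b k * rising c k * rising d k * rising e k) /
    (k.factorial * rising (1 + a - f) k *
      (rising (1 + a - b) k * rising (1 + a - c) k * rising (1 + a - d) k * rising (1 + a - e) k))

/-- **Whipple's transformation** of a terminating very-well-poised `₇F₆` into a `₄F₃`. -/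
lemma whipple (a b c d e : K) (n : ℕ)
    (hb : ∀ i < n, 1 + a - b + i ≠ 0) (hc : ∀ i < n, 1 + a - c + i ≠ 0)
    (hd : ∀ i < n, 1 + a - d + i ≠ 0) (he : ∀ i < n, 1 + a - e + i ≠ 0)
    (ha : ∀ i < 2 * n, a + 1 + i ≠ 0) :
    ∑ k ∈ range (n + 1), wellPoisedTerm a b c d e (-n) k =
      ∑ j ∈ range (n + 1), rising (1 + a - b - e) j * rising (1 + a - c - d) (n - j) *
        rising a (n + j + 1) * ((-1) ^ j * rising (-(n : K)) j * rising c j * rising d j /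
        (j.factorial * rising (1 + a + n) j * (rising (1 + a - b) j * rising (1 + a - c) n *
          rising (1 + a - d) n * rising (1 + a - e) j))) := by
  have ne {x : K} {k : ℕ} (h : ∀ i < n, x + i ≠ 0) (hk : k ≤ n) : rising x k ≠ 0 :=
    rising_ne_zero fun i hi => h i (hi.trans_le hk)
  have hn : ∀ i < n, 1 + a + n + i ≠ 0 := fun i hi => by
    convert ha (n + i) (by omega) using 1
    push_cast
    ring
  let F (k j : ℕ) : K := (a + 2 * k) * rising a k * rising (-(n : K)) k *
        (rising c k * rising d k) /
        (k.factorial * rising (1 + a + n) k * (rising (1 + a - c) k * rising (1 + a - d) k)) *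
        (rising (1 + a - b - e) j / (j.factorial * rising (1 + a - b) j * rising (1 + a - e) j) *
          (rising (-(k : K)) j * rising (a + k) j))
  have h1 : ∀ k ∈ range (n + 1),
      wellPoisedTerm a b c d e (-n) k = ∑ j ∈ range (k + 1), F k j := by
    intro k hk
    rw [wellPoisedTerm, sub_neg_eq_add]
    have hk : k ≤ n := Nat.lt_succ_iff.1 (mem_range.1 hk)
    have s := saalschutz a (1 + a - b) (1 + a - e) k (fun i hi => hb i (by omega))
      (fun i hi => he i (by omega))
    rw [show 1 + a - b + (1 + a - e) - 1 - a = 1 + a - b - e by ring,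
      show 1 + a - (1 + a - b) = b by ring, show 1 + a - (1 + a - e) = e by ring] at s
    rw [← mul_sum, s]
    have := ne hb hk
    have := ne hc hk
    have := ne hd hk
    have := ne he hk
    have := ne hn hk
    have : (k.factorial : K) ≠ 0 := by exact_mod_cast k.factorial_ne_zero
    field_simp
  rw [sum_congr rfl h1, sum_comm' (t' := range (n + 1)) (s' := fun j => Ico j (n + 1))
    (by intro k j; simp only [mem_range, mem_Ico]; omega)]
  refine sum_congr rfl fun j hj => ?_
  obtain ⟨m, rfl⟩ := Nat.exists_eq_add_of_le (Nat.lt_succ_iff.1 (mem_range.1 hj))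
  rw [sum_Ico_eq_sum_range, show j + m + 1 - j = m + 1 by omega, Nat.add_sub_cancel_left]
  have w := wellPoised_sum (a + 2 * j) (1 + a - c + j) (1 + a - d + j) m
    (fun i hi => by convert hc (j + i) (by omega) using 1; push_cast; ring)
    (fun i hi => by convert hd (j + i) (by omega) using 1; push_cast; ring)
    (fun i hi => by convert ha (2 * j + i) (by omega) using 1; push_cast; ring)
  rw [show 1 + (a + 2 * (j : K)) - (1 + a - c + j) = c + j by ring,
    show 1 + (a + 2 * (j : K)) - (1 + a - d + j) = d + j by ring,
    show 1 + a - c + j + (1 + a - d + j) - 1 - (a + 2 * (j : K)) = 1 + a - c - d by ring] at w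
  have e1 : rising a (j + m + j + 1) = rising a (2 * j) * rising (a + 2 * j) (m + 1) := by
    rw [show j + m + j + 1 = 2 * j + (m + 1) by ring, rising_add]
    push_cast
    rfl
  have hbj := ne hb (k := j) (by omega)
  have hej := ne he (k := j) (by omega)
  have hnj := ne hn (k := j) (by omega)
  have hcn := ne hc le_rfl
  have hdn := ne hd le_rfl
  rw [rising_add] at hcn hdn
  have hj0 : (j.factorial : K) ≠ 0 := by exact_mod_cast j.factorial_ne_zero
  trans rising a (2 * j) * ((-1) ^ j * rising (1 + a - b - e) j *
      rising (-((j + m : ℕ) : K)) j * rising c j * rising d j /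
      (j.factorial * rising (1 + a + (j + m : ℕ)) j * (rising (1 + a - b) j * rising (1 + a - c) j *
        rising (1 + a - d) j * rising (1 + a - e) j))) *
      (rising (a + 2 * j) (m + 1) * rising (1 + a - c - d) m /
        (rising (1 + a - c + j) m * rising (1 + a - d + j) m))
  · rw [← w, mul_sum]
    refine sum_congr rfl fun i hi => ?_
    have hi : i ≤ m := Nat.lt_succ_iff.1 (mem_range.1 hi)
    simp only [F]
    have e2 : rising a (j + i) * rising (a + (j + i : ℕ)) j =
        rising a (2 * j) * rising (a + 2 * j) i := by
      rw [← rising_add, show j + i + j = 2 * j + i by ring, rising_add]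
      push_cast
      rfl
    have e3 := rising_neg_natCast_mul_factorial (R := K) i j
    have hi0 : (i.factorial : K) ≠ 0 := by exact_mod_cast i.factorial_ne_zero
    have hij0 : ((j + i).factorial : K) ≠ 0 := by exact_mod_cast (j + i).factorial_ne_zero
    have hci := ne hc (k := j + i) (by omega)
    have hdi := ne hd (k := j + i) (by omega)
    have hni := ne hn (k := j + i) (by omega)
    rw [rising_add] at hci hdi hni
    rw [show (1 : K) + (a + 2 * j) + m = 1 + a + (j + m : ℕ) + j by push_cast; ring,
      show -(m : K) = -((j + m : ℕ) : K) + j by push_cast; ring]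
    rw [rising_add (1 + a - c), rising_add (1 + a - d), rising_add (1 + a + (j + m : ℕ)),
      rising_add c, rising_add d, rising_add (-((j + m : ℕ) : K))]
    have hc1 := left_ne_zero_of_mul hci
    have hc2 := right_ne_zero_of_mul hci
    have hd1 := left_ne_zero_of_mul hdi
    have hd2 := right_ne_zero_of_mul hdi
    have hn1 := left_ne_zero_of_mul hni
    have hn2 := right_ne_zero_of_mul hni
    push_cast at e2 e3 hn1 hn2 hnj ⊢
    field_simp
    linear_combination (a + 2 * (j + i)) * rising (-((j : K) + m)) j *
      rising (-((j : K) + m) + j) i * rising c j * rising (c + j) i * rising d j *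
      rising (d + j) i * rising (1 + a - b - e) j *
      (rising (-((j : K) + i)) j * i.factorial * e2 + rising a (2 * j) * rising (a + 2 * j) i * e3)
  · have hc1 := left_ne_zero_of_mul hcn
    have hc2 := right_ne_zero_of_mul hcn
    have hd1 := left_ne_zero_of_mul hdn
    have hd2 := right_ne_zero_of_mul hdn
    rw [e1, rising_add (1 + a - c), rising_add (1 + a - d)]
    field_simp

lemma sum_range_eq_zero_of_reflect {n : ℕ} (f : ℕ → K)
    (h : ∀ k ≤ n, f (n - k) = -f k) : ∑ k ∈ range (n + 1), f k = 0 := by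
  have h1 := sum_range_reflect f (n + 1)
  rw [sum_congr rfl (g := fun k => -f k) (fun k hk => by
    rw [← h k (Nat.lt_succ_iff.1 (mem_range.1 hk))]; simp), sum_neg_distrib] at h1
  exact self_eq_neg.1 h1.symm

lemma rising_div_reflect {n k : ℕ} (hk : k ≤ n) (b : K) (h : rising b n ≠ 0) :
    rising b k / rising (1 - n - b) k = (-1) ^ k * (rising b k * rising b (n - k)) / rising b n := by
  obtain ⟨m, rfl⟩ := Nat.exists_eq_add_of_le hk
  have h1 : rising (1 - ((k + m : ℕ) : K) - b) k = (-1) ^ k * rising (b + m) k := by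
    rw [← rising_reflect]
    push_cast
    ring_nf
  rw [Nat.add_sub_cancel_left, h1]
  rw [add_comm k m, rising_add] at h ⊢
  have := left_ne_zero_of_mul h
  have := right_ne_zero_of_mul h
  field_simp
  rw [← pow_mul, mul_comm k 2, pow_mul]
  simp

/-- A well-poised series with base a negative integer `-n` is antisymmetric under `k ↦ n - k`. -/
lemma wellPoised_antisymm (b c d e f : K) (n : ℕ)
    (hb : rising b n ≠ 0) (hc : rising c n ≠ 0) (hd : rising d n ≠ 0) (he : rising e n ≠ 0)
    (hf : rising f n ≠ 0) :
    ∑ k ∈ range (n + 1), wellPoisedTerm (-(n : K)) b c d e f k = 0 := by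
  have key : ∀ k ∈ range (n + 1), wellPoisedTerm (-(n : K)) b c d e f k =
      (-n + 2 * k) * n.choose k * (rising b k * rising b (n - k) / rising b n) *
        (rising c k * rising c (n - k) / rising c n) *
        (rising d k * rising d (n - k) / rising d n) *
        (rising e k * rising e (n - k) / rising e n) *
        (rising f k * rising f (n - k) / rising f n) := by
    intro k hk
    have hk : k ≤ n := Nat.lt_succ_iff.1 (mem_range.1 hk)
    have h0 : (k.factorial : K) ≠ 0 := by exact_mod_cast k.factorial_ne_zero
    have hs : ((-1 : K) ^ k) ^ 6 = 1 := by rw [← pow_mul, mul_comm, pow_mul]; norm_num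
    trans (-n + 2 * k) * (rising (-(n : K)) k / k.factorial) *
      (rising b k / rising (1 - n - b) k) * (rising c k / rising (1 - n - c) k) *
      (rising d k / rising (1 - n - d) k) * (rising e k / rising (1 - n - e) k) *
      (rising f k / rising (1 - n - f) k)
    · simp only [wellPoisedTerm, ← sub_eq_add_neg, div_eq_mul_inv, mul_inv]
      ring
    · rw [rising_neg_natCast_eq_choose hk, rising_div_reflect hk b hb, rising_div_reflect hk c hc,
        rising_div_reflect hk d hd, rising_div_reflect hk e he, rising_div_reflect hk f hf,
        mul_div_cancel_right₀ _ h0]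
      linear_combination ((-n + 2 * k) * n.choose k * (rising b k * rising b (n - k) / rising b n) *
        (rising c k * rising c (n - k) / rising c n) *
        (rising d k * rising d (n - k) / rising d n) *
        (rising e k * rising e (n - k) / rising e n) *
        (rising f k * rising f (n - k) / rising f n)) * hs
  rw [sum_congr rfl key]
  refine sum_range_eq_zero_of_reflect _ fun k hk => ?_
  rw [Nat.choose_symm hk, Nat.sub_sub_self hk, Nat.cast_sub hk]
  ring

end Field

lemma not_dvd_of_abs_lt {p : ℕ} {m : ℤ} (h0 : m ≠ 0) (h1 : m < p) (h2 : -p < m) :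
    ¬ (p : ℤ) ∣ m :=
  fun h => h0 (Int.eq_zero_of_abs_lt_dvd h (abs_lt.2 ⟨h2, h1⟩))

lemma inv_mul_inv_eq_zpow {p : ℕ} : (p : ℝ)⁻¹ * (p : ℝ)⁻¹ = (p : ℝ) ^ (-2 : ℤ) := by
  rw [zpow_neg, ← mul_inv, ← sq]
  rfl

section Padic

variable {p : ℕ} [hp : Fact p.Prime]

lemma norm_le_inv_of_lt_one {x : ℚ_[p]} (h : ‖x‖ < 1) : ‖x‖ ≤ (p : ℝ)⁻¹ := by
  simpa using (Padic.norm_le_pow_iff_norm_lt_pow_add_one x (-1)).2 (by simpa using h)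

lemma norm_add_lt_one {x y : ℚ_[p]} (hx : ‖x‖ < 1) (hy : ‖y‖ < 1) : ‖x + y‖ < 1 :=
  (Padic.nonarchimedean x y).trans_lt (max_lt hx hy)

lemma norm_sub_lt_one {x y : ℚ_[p]} (hx : ‖x‖ < 1) (hy : ‖y‖ < 1) : ‖x - y‖ < 1 := by
  rw [sub_eq_add_neg]
  exact norm_add_lt_one hx (by rwa [norm_neg])

lemma norm_le_one_of_near {z : ℚ_[p]} {r : ℤ} (h : ‖z + r‖ < 1) : ‖z‖ ≤ 1 := by
  have := Padic.nonarchimedean (z + (r : ℚ_[p])) ((-r : ℤ) : ℚ_[p])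
  rw [show z + r + ((-r : ℤ) : ℚ_[p]) = z by push_cast; ring] at this
  exact this.trans (max_le h.le (Padic.norm_int_le_one _))

lemma norm_add_natCast_lt_one {z : ℚ_[p]} {r : ℤ} (h : ‖z + r‖ < 1) {i : ℕ}
    (hi : (p : ℤ) ∣ i - r) : ‖z + i‖ < 1 := by
  rw [show z + i = z + r + ((i - r : ℤ) : ℚ_[p]) by push_cast; ring]
  exact norm_add_lt_one h (Padic.norm_intCast_lt_one_iff.2 hi)

lemma norm_add_natCast_eq_one {z : ℚ_[p]} {r : ℤ} (h : ‖z + r‖ < 1) {i : ℕ}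
    (hi : ¬ (p : ℤ) ∣ i - r) : ‖z + i‖ = 1 := by
  have h1 : ‖((i - r : ℤ) : ℚ_[p])‖ = 1 :=
    le_antisymm (Padic.norm_int_le_one _) (not_lt.1 fun hl => hi (Padic.norm_intCast_lt_one_iff.1 hl))
  rw [show z + i = z + r + ((i - r : ℤ) : ℚ_[p]) by push_cast; ring,
    IsUltrametricDist.norm_add_eq_max_of_norm_ne_norm (by rw [h1]; exact h.ne), h1,
    max_eq_right h.le]

lemma norm_rising_le_one {z : ℚ_[p]} (hz : ‖z‖ ≤ 1) (k : ℕ) : ‖rising z k‖ ≤ 1 := by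
  rw [rising, norm_prod]
  exact prod_le_one (fun _ _ => norm_nonneg _) fun i _ =>
    (Padic.nonarchimedean z i).trans (max_le hz (by simpa using Padic.norm_int_le_one (p := p) i))

lemma norm_rising_anti {z : ℚ_[p]} (hz : ‖z‖ ≤ 1) {k m : ℕ} (h : k ≤ m) :
    ‖rising z m‖ ≤ ‖rising z k‖ := by
  obtain ⟨n, rfl⟩ := Nat.exists_eq_add_of_le h
  rw [rising_add, norm_mul]
  refine mul_le_of_le_one_right (norm_nonneg _) (norm_rising_le_one ?_ n)
  exact (Padic.nonarchimedean z k).trans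
    (max_le hz (by simpa using Padic.norm_int_le_one (p := p) k))

lemma norm_rising_le_inv {z : ℚ_[p]} {r : ℤ} (h : ‖z + r‖ < 1) {i k : ℕ} (hik : i < k)
    (hi : (p : ℤ) ∣ i - r) : ‖rising z k‖ ≤ (p : ℝ)⁻¹ := by
  have hz := norm_le_one_of_near h
  refine (norm_rising_anti hz (Nat.succ_le_of_lt hik)).trans ?_
  rw [Nat.succ_eq_add_one, rising_succ, norm_mul]
  exact (mul_le_of_le_one_left (norm_nonneg _) (norm_rising_le_one hz i)).trans
    (norm_le_inv_of_lt_one (norm_add_natCast_lt_one h hi))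

lemma norm_rising_eq_one {z : ℚ_[p]} {r : ℤ} (h : ‖z + r‖ < 1) {k : ℕ}
    (hk : ∀ i < k, ¬ (p : ℤ) ∣ i - r) : ‖rising z k‖ = 1 := by
  rw [rising, norm_prod]
  exact prod_eq_one fun i hi => norm_add_natCast_eq_one h (hk i (mem_range.1 hi))

lemma norm_factorial_eq_one {k : ℕ} (hk : k < p) : ‖(k.factorial : ℚ_[p])‖ = 1 := by
  rw [← rising_one_eq_factorial]
  exact norm_rising_eq_one (r := -1) (by simp) fun i hi =>
    not_dvd_of_abs_lt (by omega) (by omega) (by omega)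

/-- `Mixed x φ` says that the mixed second difference of `φ` with step `x` at the origin is
divisible by `x ^ 2`, its first differences by `x`, and that its value is a `p`-adic integer. -/
def Mixed (x : ℤ_[p]) (φ : ℚ_[p] → ℚ_[p] → ℚ_[p]) : Prop :=
  ∃ c s t r : ℤ_[p], φ 0 0 = c ∧ φ x 0 = c + x * s ∧ φ 0 x = c + x * t ∧
    φ x x = c + x * s + x * t + x ^ 2 * r

namespace Mixed

variable {x : ℤ_[p]} {φ ψ : ℚ_[p] → ℚ_[p] → ℚ_[p]}

lemma const {c : ℚ_[p]} (hc : ‖c‖ ≤ 1) : Mixed x fun _ _ => c :=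
  ⟨⟨c, hc⟩, 0, 0, 0, by simp⟩

lemma fst : Mixed x fun u _ => u := ⟨0, 1, 0, 0, by simp⟩

lemma snd : Mixed x fun _ v => v := ⟨0, 0, 1, 0, by simp⟩

lemma natCast (n : ℕ) : Mixed x fun _ _ => (n : ℚ_[p]) :=
  const (by simpa using Padic.norm_int_le_one (p := p) n)

lemma add (hφ : Mixed x φ) (hψ : Mixed x ψ) : Mixed x fun u v => φ u v + ψ u v := by
  obtain ⟨c, s, t, r, h1, h2, h3, h4⟩ := hφ
  obtain ⟨c', s', t', r', h1', h2', h3', h4'⟩ := hψ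
  refine ⟨c + c', s + s', t + t', r + r', ?_, ?_, ?_, ?_⟩ <;>
    simp only [h1, h2, h3, h4, h1', h2', h3', h4'] <;> push_cast <;> ring

lemma mul (hφ : Mixed x φ) (hψ : Mixed x ψ) : Mixed x fun u v => φ u v * ψ u v := by
  obtain ⟨c, s, t, r, h1, h2, h3, h4⟩ := hφ
  obtain ⟨c', s', t', r', h1', h2', h3', h4'⟩ := hψ
  refine ⟨c * c', c * s' + s * c' + x * s * s', c * t' + t * c' + x * t * t',
    c * r' + r * c' + s * t' + t * s' + x * (s * r' + r * s' + t * r' + r * t') + x ^ 2 * r * r',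
    ?_, ?_, ?_, ?_⟩ <;>
    simp only [h1, h2, h3, h4, h1', h2', h3', h4'] <;> push_cast <;> ring

lemma neg (hφ : Mixed x φ) : Mixed x fun u v => -φ u v := by
  simpa using (const (x := x) (c := -1) (by simp)).mul hφ

lemma sub (hφ : Mixed x φ) (hψ : Mixed x ψ) : Mixed x fun u v => φ u v - ψ u v := by
  simpa only [sub_eq_add_neg] using hφ.add hψ.neg

lemma inv (hφ : Mixed x φ) (hx : ‖x‖ < 1)
    (h : ∀ u v : ℚ_[p], ‖u‖ < 1 → ‖v‖ < 1 → ‖φ u v‖ = 1) : Mixed x fun u v => (φ u v)⁻¹ := by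
  obtain ⟨c, s, t, r, h1, h2, h3, h4⟩ := hφ
  have n1 := h 0 0 (by simp) (by simp)
  have n2 := h x 0 hx (by simp)
  have n3 := h 0 x (by simp) hx
  have n4 := h x x hx hx
  have ne {z : ℚ_[p]} (hz : ‖z‖ = 1) : z ≠ 0 := norm_ne_zero_iff.1 (by simp [hz])
  have d1 := ne n1
  have d2 := ne n2
  have d3 := ne n3
  have d4 := ne n4
  let i1 : ℤ_[p] := ⟨(φ 0 0)⁻¹, by simp [n1]⟩
  let i2 : ℤ_[p] := ⟨(φ x 0)⁻¹, by simp [n2]⟩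
  let i3 : ℤ_[p] := ⟨(φ 0 x)⁻¹, by simp [n3]⟩
  let i4 : ℤ_[p] := ⟨(φ x x)⁻¹, by simp [n4]⟩
  have e1 : (i1 : ℚ_[p]) = (φ 0 0)⁻¹ := rfl
  have e2 : (i2 : ℚ_[p]) = (φ x 0)⁻¹ := rfl
  have e3 : (i3 : ℚ_[p]) = (φ 0 x)⁻¹ := rfl
  have e4 : (i4 : ℚ_[p]) = (φ x x)⁻¹ := rfl
  refine ⟨i1, -(s * i2 * i1), -(t * i3 * i1),
    t * (i4 * (s * i2 * i1) + i1 * i4 * i3 * (s + x * r)) - r * i4 * i2, ?_, ?_, ?_, ?_⟩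
  · rfl
  all_goals
    push_cast
    simp only [e1, e2, e3, e4]
    rw [h1] at d1 ⊢
    try rw [h2] at d2 ⊢
    try rw [h3] at d3 ⊢
    try rw [h4] at d4 ⊢
    field_simp
    ring

lemma div (hφ : Mixed x φ) (hψ : Mixed x ψ) (hx : ‖x‖ < 1)
    (h : ∀ u v : ℚ_[p], ‖u‖ < 1 → ‖v‖ < 1 → ‖ψ u v‖ = 1) : Mixed x fun u v => φ u v / ψ u v := by
  simpa only [div_eq_mul_inv] using hφ.mul (hψ.inv hx h)

lemma rising (hφ : Mixed x φ) (k : ℕ) : Mixed x fun u v => rising (φ u v) k := by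
  induction k with
  | zero => simpa using natCast (x := x) 1
  | succ k ih => simpa only [rising_succ] using ih.mul (hφ.add (natCast k))

lemma sum {φ : ℕ → ℚ_[p] → ℚ_[p] → ℚ_[p]} {n : ℕ} (h : ∀ k < n, Mixed x (φ k)) :
    Mixed x fun u v => ∑ k ∈ range n, φ k u v := by
  induction n with
  | zero => simpa using natCast (x := x) 0
  | succ n ih =>
    simpa only [sum_range_succ] using (ih fun k hk => h k (by omega)).add (h n (by omega))

lemma norm_diag_le (hφ : Mixed x φ) (hx : ‖x‖ < 1) (h0 : φ 0 0 = 0) (h1 : φ 0 x = 0)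
    (h2 : ‖φ x 0‖ ≤ (p : ℝ) ^ (-2 : ℤ)) : ‖φ x x‖ ≤ (p : ℝ) ^ (-2 : ℤ) := by
  obtain ⟨c, s, t, r, e1, e2, e3, e4⟩ := hφ
  have e : φ x x = φ x 0 + x ^ 2 * r := by
    rw [e4, e2]
    linear_combination h1 - e3 + e1 - h0
  rw [e]
  refine (Padic.nonarchimedean _ _).trans (max_le h2 ?_)
  have hx' : ‖(x : ℚ_[p])‖ ≤ (p : ℝ)⁻¹ := norm_le_inv_of_lt_one hx
  rw [norm_mul, norm_pow]
  calc ‖(x : ℚ_[p])‖ ^ 2 * ‖(r : ℚ_[p])‖ ≤ ((p : ℝ)⁻¹) ^ 2 * 1 := by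
        gcongr
        exact r.2
    _ = (p : ℝ) ^ (-2 : ℤ) := by rw [zpow_neg]; norm_cast; simp

end Mixed

lemma norm_one_add_sub_near {z w : ℚ_[p]} {m n : ℤ} (hz : ‖z + m‖ < 1) (hw : ‖w + n‖ < 1) :
    ‖1 + z - w + ((m - n - 1 : ℤ) : ℚ_[p])‖ < 1 := by
  rw [show 1 + z - w + ((m - n - 1 : ℤ) : ℚ_[p]) = (z + m) - (w + n) by push_cast; ring]
  exact norm_sub_lt_one hz hw

lemma norm_div_le_zpow {α b : ℚ_[p]} {m n k : ℕ} (hα : ‖α + (m : ℤ)‖ < 1) (hb : ‖b + (n : ℤ)‖ < 1)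
    (hmn : m ≤ n) (hnp : n < p) (hk : k < p)
    (h : (p : ℝ) ^ (-2 : ℤ) < ‖rising (1 + α - b) (p - 1)‖) :
    ‖rising b k / rising (1 + α - b) k‖ ≤
      (p : ℝ) ^ ((if p + m ≤ k + n then 1 else 0) - (if n < k then 1 else 0) : ℤ) := by
  have hp0 : (0 : ℝ) < p := by exact_mod_cast hp.out.pos
  have hab := norm_one_add_sub_near hα hb
  have hnum : ‖rising b k‖ ≤ (p : ℝ) ^ (-(if n < k then 1 else 0) : ℤ) := by
    split_ifs with hc
    · simpa using norm_rising_le_inv hb hc (by simp)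
    · simpa using norm_rising_le_one (norm_le_one_of_near hb) k
  have hden : (p : ℝ) ^ (-(if p + m ≤ k + n then 1 else 0) : ℤ) ≤ ‖rising (1 + α - b) k‖ := by
    split_ifs with hc
    · by_contra! hlt
      rw [show (-1 : ℤ) = -2 + 1 by norm_num, ← Padic.norm_le_pow_iff_norm_lt_pow_add_one] at hlt
      exact absurd h (not_lt.2
        ((norm_rising_anti (norm_le_one_of_near hab) (by omega)).trans hlt))
    · rw [norm_rising_eq_one hab fun i hi =>
        not_dvd_of_abs_lt (by omega) (by omega) (by omega)]
      simp
  rw [norm_div, sub_eq_neg_add _ (ite _ _ _), zpow_add₀ hp0.ne', div_eq_mul_inv]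
  refine mul_le_mul hnum ?_ (by positivity) (by positivity)
  rw [← inv_inv ((p : ℝ) ^ (_ : ℤ)), ← zpow_neg]
  exact inv_anti₀ (by positivity) hden

section Residues

variable {α β γ δ ε : ℚ_[p]} {a b c d e : ℕ}

lemma norm_wellPoisedTerm_le_of_lt (hα : ‖α + (a : ℤ)‖ < 1)
    (hβ : ‖β + (b : ℤ)‖ < 1) (hγ : ‖γ + (c : ℤ)‖ < 1)
    (hδ : ‖δ + (d : ℤ)‖ < 1) (hε : ‖ε + (e : ℤ)‖ < 1)
    (hab : a ≤ b) (hac : a ≤ c) (had : a ≤ d) (hae : a ≤ e)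
    (hb : b < p) (hc : c < p) (hd : d < p) (he : e < p)
    (hbe : b + e < p + a) (hcd : c + d < p + a)
    (hβp : (p : ℝ) ^ (-2 : ℤ) < ‖rising (1 + α - β) (p - 1)‖)
    (hγp : (p : ℝ) ^ (-2 : ℤ) < ‖rising (1 + α - γ) (p - 1)‖)
    (hδp : (p : ℝ) ^ (-2 : ℤ) < ‖rising (1 + α - δ) (p - 1)‖)
    (hεp : (p : ℝ) ^ (-2 : ℤ) < ‖rising (1 + α - ε) (p - 1)‖)
    {k : ℕ} (hak : a < k) (hk : k < p) :
    ‖wellPoisedTerm α β γ δ ε α k‖ ≤ (p : ℝ) ^ (-2 : ℤ) := by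
  have hp0 : (0 : ℝ) < p := by exact_mod_cast hp.out.pos
  have hp1 : (1 : ℝ) ≤ p := by exact_mod_cast hp.out.one_le
  have hα1 := norm_le_one_of_near hα
  have h1 : ‖α + 2 * k‖ ≤ 1 := (Padic.nonarchimedean _ _).trans (max_le hα1
    (by simpa using Padic.norm_int_le_one (p := p) (2 * k)))
  have h2 : ‖rising α k‖ ≤ (p : ℝ)⁻¹ := norm_rising_le_inv hα hak (by simp)
  have h3 : ‖(k.factorial : ℚ_[p])‖ = 1 := norm_factorial_eq_one hk
  have hB := norm_div_le_zpow hα hβ hab hb hk hβp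
  have hC := norm_div_le_zpow hα hγ hac hc hk hγp
  have hD := norm_div_le_zpow hα hδ had hd hk hδp
  have hE := norm_div_le_zpow hα hε hae he hk hεp
  have key : ‖rising β k / rising (1 + α - β) k‖ * ‖rising γ k / rising (1 + α - γ) k‖ *
      ‖rising δ k / rising (1 + α - δ) k‖ * ‖rising ε k / rising (1 + α - ε) k‖ ≤ 1 := by
    refine (mul_le_mul (mul_le_mul (mul_le_mul hB hC (by positivity) (by positivity)) hD
      (by positivity) (by positivity)) hE (by positivity) (by positivity)).trans ?_
    rw [← zpow_add₀ hp0.ne', ← zpow_add₀ hp0.ne', ← zpow_add₀ hp0.ne']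
    refine zpow_le_one_of_nonpos₀ hp1 ?_
    split_ifs <;> omega
  have e1 : wellPoisedTerm α β γ δ ε α k = (α + 2 * k) * (rising α k * rising α k) *
      (rising β k / rising (1 + α - β) k * (rising γ k / rising (1 + α - γ) k) *
      (rising δ k / rising (1 + α - δ) k) * (rising ε k / rising (1 + α - ε) k)) /
      (k.factorial * k.factorial) := by
    rw [wellPoisedTerm, add_sub_cancel_right, rising_one_eq_factorial]
    simp only [div_eq_mul_inv, mul_inv]
    ring
  rw [e1, norm_div, norm_mul _ (k.factorial : ℚ_[p]), h3, mul_one, div_one]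
  simp only [norm_mul] at key ⊢
  calc _ ≤ 1 * ((p : ℝ)⁻¹ * (p : ℝ)⁻¹) * 1 := by gcongr
    _ = (p : ℝ) ^ (-2 : ℤ) := by rw [mul_one, one_mul, inv_mul_inv_eq_zpow]

lemma norm_rising_one_add_sub_eq_one (hα : ‖α + (a : ℤ)‖ < 1) (hβ : ‖β + (b : ℤ)‖ < 1)
    (hab : a ≤ b) (hb : b < p) {k : ℕ} (hk : k ≤ a) : ‖rising (1 + α - β) k‖ = 1 :=
  norm_rising_eq_one (norm_one_add_sub_near hα hβ) fun i hi =>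
    not_dvd_of_abs_lt (by omega) (by omega) (by omega)

lemma rising_ne_zero_of_near (hβ : ‖β + (b : ℤ)‖ < 1) (hab : a ≤ b) (hb : b < p) :
    rising β a ≠ 0 := by
  rw [← norm_ne_zero_iff, norm_rising_eq_one hβ fun i hi =>
    not_dvd_of_abs_lt (by omega) (by omega) (by omega)]
  exact one_ne_zero

/-- The terminating series is `0` modulo `p ^ 2`, by Whipple's transformation: every term
of the `₄F₃` carries the factor `α + a` and one further factor divisible by `p`. -/
lemma norm_sum_wellPoisedTerm_terminating_le (hα : ‖α + (a : ℤ)‖ < 1) (hα0 : α + a ≠ 0)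
    (hβ : ‖β + (b : ℤ)‖ < 1) (hγ : ‖γ + (c : ℤ)‖ < 1)
    (hδ : ‖δ + (d : ℤ)‖ < 1) (hε : ‖ε + (e : ℤ)‖ < 1)
    (hab : a ≤ b) (hac : a ≤ c) (had : a ≤ d) (hae : a ≤ e)
    (hb : b < p) (hc : c < p) (hd : d < p) (he : e < p)
    (hbe : b + e < p + a) (hcd : c + d < p + a) (hsum : 2 * p + a ≤ b + c + d + e + 1) :
    ‖∑ k ∈ range (a + 1), wellPoisedTerm α β γ δ ε (-(a : ℚ_[p])) k‖ ≤ (p : ℝ) ^ (-2 : ℤ) := by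
  have hp0 : (0 : ℝ) < p := by exact_mod_cast hp.out.pos
  have hα1 := norm_le_one_of_near hα
  have ha1 : ‖-(a : ℚ_[p])‖ ≤ 1 := by simpa using Padic.norm_int_le_one (p := p) a
  have ne {z w : ℚ_[p]} {m n : ℕ} (hz : ‖z + (m : ℤ)‖ < 1) (hw : ‖w + (n : ℤ)‖ < 1)
      (hmn : m ≤ n) (hn : n < p) : ∀ i < m, 1 + z - w + i ≠ 0 := fun i hi => by
    rw [← norm_ne_zero_iff, norm_add_natCast_eq_one (norm_one_add_sub_near hz hw)
      (not_dvd_of_abs_lt (by omega) (by omega) (by omega))]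
    exact one_ne_zero
  rw [whipple α β γ δ ε a (ne hα hβ hab hb) (ne hα hγ hac hc) (ne hα hδ had hd) (ne hα hε hae he)]
  · refine IsUltrametricDist.norm_sum_le_of_forall_le_of_nonneg (by positivity) fun j hj => ?_
    have hj : j ≤ a := Nat.lt_succ_iff.1 (mem_range.1 hj)
    have near {z w : ℚ_[p]} {m n : ℕ} (hz : ‖z + (m : ℤ)‖ < 1) (hw : ‖w + (n : ℤ)‖ < 1) :
        ‖1 + α - z - w + ((a - m - n - 1 : ℤ) : ℚ_[p])‖ < 1 := by
      rw [show 1 + α - z - w + ((a - m - n - 1 : ℤ) : ℚ_[p]) =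
        (α + (a : ℤ)) - (z + (m : ℤ)) - (w + (n : ℤ)) by push_cast; ring]
      exact norm_sub_lt_one (norm_sub_lt_one hα hz) hw
    have hw1 := near hβ hε
    have hw2 := near hγ hδ
    have h1 : ‖rising (1 + α - β - ε) j * rising (1 + α - γ - δ) (a - j)‖ ≤ (p : ℝ)⁻¹ := by
      rw [norm_mul]
      by_cases h : p + a ≤ j + b + e
      · refine (mul_le_of_le_one_right (norm_nonneg _)
          (norm_rising_le_one (norm_le_one_of_near hw2) _)).trans
          (norm_rising_le_inv hw1 (i := p + a - b - e - 1) (by omega) ?_)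
        rw [show (((p + a - b - e - 1 : ℕ) : ℤ) - (a - b - e - 1)) = p by omega]
      · refine (mul_le_of_le_one_left (norm_nonneg _)
          (norm_rising_le_one (norm_le_one_of_near hw1) _)).trans
          (norm_rising_le_inv hw2 (i := p + a - c - d - 1) (by omega) ?_)
        rw [show (((p + a - c - d - 1 : ℕ) : ℤ) - (a - c - d - 1)) = p by omega]
    have h2 : ‖rising α (a + j + 1)‖ ≤ (p : ℝ)⁻¹ :=
      norm_rising_le_inv hα (i := a) (by omega) (by simp)
    have h3 : ‖rising (1 + α + a) j‖ = 1 :=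
      norm_rising_eq_one (r := -1)
        (by convert hα using 2; push_cast; ring) fun i hi =>
          not_dvd_of_abs_lt (by omega) (by omega) (by omega)
    have hnum : ‖(-1) ^ j * rising (-(a : ℚ_[p])) j * rising γ j * rising δ j‖ ≤ 1 := by
      simp only [norm_mul, norm_pow, norm_neg, norm_one, one_pow, one_mul]
      exact mul_le_one₀ (mul_le_one₀ (norm_rising_le_one ha1 j) (norm_nonneg _)
        (norm_rising_le_one (norm_le_one_of_near hγ) j)) (norm_nonneg _)
        (norm_rising_le_one (norm_le_one_of_near hδ) j)
    have hden : ‖(j.factorial : ℚ_[p]) * rising (1 + α + a) j * (rising (1 + α - β) j *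
        rising (1 + α - γ) a * rising (1 + α - δ) a * rising (1 + α - ε) j)‖ = 1 := by
      simp only [norm_mul, h3, norm_factorial_eq_one (show j < p by omega),
        norm_rising_one_add_sub_eq_one hα hβ hab hb hj,
        norm_rising_one_add_sub_eq_one hα hγ hac hc le_rfl,
        norm_rising_one_add_sub_eq_one hα hδ had hd le_rfl,
        norm_rising_one_add_sub_eq_one hα hε hae he hj, mul_one]
    rw [norm_mul, norm_mul _ (rising α (a + j + 1)), norm_div, hden, div_one]
    calc _ ≤ (p : ℝ)⁻¹ * (p : ℝ)⁻¹ * 1 := by gcongr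
      _ = (p : ℝ) ^ (-2 : ℤ) := by rw [mul_one, inv_mul_inv_eq_zpow]
  · intro i hi
    by_cases hia : i + 1 = a
    · rw [← hia] at hα0
      convert hα0 using 1
      push_cast
      ring
    · have := norm_add_natCast_eq_one (i := i + 1) hα
        (not_dvd_of_abs_lt (by omega) (by omega) (by omega))
      rw [show α + 1 + (i : ℚ_[p]) = α + (i + 1 : ℕ) by push_cast; ring, ← norm_ne_zero_iff, this]
      exact one_ne_zero

lemma mixed_wellPoisedTerm {x : ℤ_[p]} (hx : ‖x‖ < 1)
    (hβ : ‖β + (b : ℤ)‖ < 1) (hγ : ‖γ + (c : ℤ)‖ < 1)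
    (hδ : ‖δ + (d : ℤ)‖ < 1) (hε : ‖ε + (e : ℤ)‖ < 1)
    (hab : a ≤ b) (hac : a ≤ c) (had : a ≤ d) (hae : a ≤ e)
    (hb : b < p) (hc : c < p) (hd : d < p) (he : e < p) {k : ℕ} (hk : k ≤ a) :
    Mixed x fun u v => wellPoisedTerm (-(a : ℚ_[p]) + u) β γ δ ε (-(a : ℚ_[p]) + v) k := by
  have hu : Mixed x fun u _ => -(a : ℚ_[p]) + u := (Mixed.natCast a).neg.add Mixed.fst
  have hv : Mixed x fun _ v => -(a : ℚ_[p]) + v := (Mixed.natCast a).neg.add Mixed.snd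
  have hcst {z : ℚ_[p]} {n : ℕ} (hz : ‖z + (n : ℤ)‖ < 1) : Mixed x fun _ _ => z :=
    Mixed.const (norm_le_one_of_near hz)
  have h1 : Mixed x fun u _ => 1 + (-(a : ℚ_[p]) + u) := by
    simpa using (Mixed.natCast (x := x) 1).add hu
  have h2 : Mixed x fun _ _ => 2 * (k : ℚ_[p]) := by
    simpa using Mixed.natCast (x := x) (2 * k)
  have near {u : ℚ_[p]} (hu : ‖u‖ < 1) : ‖-(a : ℚ_[p]) + u + (a : ℤ)‖ < 1 := by
    convert hu using 2
    push_cast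
    ring
  unfold wellPoisedTerm
  refine Mixed.div ((((hu.add h2).mul (hu.rising k)).mul (hv.rising k)).mul
    (((((hcst hβ).rising k).mul ((hcst hγ).rising k)).mul ((hcst hδ).rising k)).mul
      ((hcst hε).rising k)))
    (((Mixed.natCast _).mul ((h1.sub hv).rising k)).mul
    (((((h1.sub (hcst hβ)).rising k).mul ((h1.sub (hcst hγ)).rising k)).mul
      ((h1.sub (hcst hδ)).rising k)).mul ((h1.sub (hcst hε)).rising k))) hx fun u v hu hv => ?_
  simp only [norm_mul, norm_factorial_eq_one (show k < p by omega),
    norm_rising_one_add_sub_eq_one (near hu) (near hv) le_rfl (by omega) hk,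
    norm_rising_one_add_sub_eq_one (near hu) hβ hab hb hk,
    norm_rising_one_add_sub_eq_one (near hu) hγ hac hc hk,
    norm_rising_one_add_sub_eq_one (near hu) hδ had hd hk,
    norm_rising_one_add_sub_eq_one (near hu) hε hae he hk, mul_one]

/-- The initial part of the series is `0` modulo `p ^ 2`. -/
lemma norm_sum_wellPoisedTerm_head_le (hα : ‖α + (a : ℤ)‖ < 1)
    (hβ : ‖β + (b : ℤ)‖ < 1) (hγ : ‖γ + (c : ℤ)‖ < 1)
    (hδ : ‖δ + (d : ℤ)‖ < 1) (hε : ‖ε + (e : ℤ)‖ < 1)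
    (hab : a ≤ b) (hac : a ≤ c) (had : a ≤ d) (hae : a ≤ e)
    (hb : b < p) (hc : c < p) (hd : d < p) (he : e < p)
    (hbe : b + e < p + a) (hcd : c + d < p + a) (hsum : 2 * p + a ≤ b + c + d + e + 1) :
    ‖∑ k ∈ range (a + 1), wellPoisedTerm α β γ δ ε α k‖ ≤ (p : ℝ) ^ (-2 : ℤ) := by
  let x : ℤ_[p] := ⟨α + a, by simpa using hα.le⟩
  have hx : ‖x‖ < 1 := by simpa [x] using hα
  have hxα : -(a : ℚ_[p]) + (x : ℚ_[p]) = α := by simp [x]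
  have vanish : ∀ v : ℚ_[p], ‖v‖ < 1 →
      ∑ k ∈ range (a + 1), wellPoisedTerm (-(a : ℚ_[p]) + 0) β γ δ ε (-(a : ℚ_[p]) + v) k = 0 := by
    intro v hv
    rw [add_zero]
    refine wellPoised_antisymm β γ δ ε _ a (rising_ne_zero_of_near hβ hab hb)
      (rising_ne_zero_of_near hγ hac hc) (rising_ne_zero_of_near hδ had hd)
      (rising_ne_zero_of_near hε hae he) (rising_ne_zero_of_near (b := a) ?_ le_rfl (by omega))
    convert hv using 2
    push_cast
    ring
  have key := Mixed.norm_diag_le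
    (Mixed.sum (n := a + 1) fun k hk => mixed_wellPoisedTerm hx hβ hγ hδ hε hab hac had hae
      hb hc hd he (Nat.lt_succ_iff.1 hk)) hx (vanish 0 (by simp)) (vanish x hx)
  rw [hxα, add_zero] at key
  refine key ?_
  by_cases h0 : α + a = 0
  · rw [show α = -(a : ℚ_[p]) + 0 by linear_combination h0]
    have := vanish 0 (by simp)
    rw [add_zero (-(a : ℚ_[p]))] at this ⊢
    rw [this, norm_zero]
    positivity
  · exact norm_sum_wellPoisedTerm_terminating_le hα h0 hβ hγ hδ hε hab hac had hae hb hc hd he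
      hbe hcd hsum

end Residues

lemma norm_add_res_lt_one (z : ℤ_[p]) : ‖(z : ℚ_[p]) + ((res p (-z) : ℤ) : ℚ_[p])‖ < 1 := by
  have h : z + (res p (-z) : ℤ_[p]) ∈ RingHom.ker (PadicInt.toZMod (p := p)) := by
    rw [RingHom.mem_ker, map_add, map_natCast, res, ZMod.natCast_zmod_val, map_neg, add_neg_cancel]
  rw [PadicInt.ker_toZMod, PadicInt.maximalIdeal_eq_span_p, Ideal.mem_span_singleton,
    ← PadicInt.norm_lt_one_iff_dvd, PadicInt.norm_def] at h
  simpa using h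

lemma coe_rising (z : ℤ_[p]) (k : ℕ) : ((rising z k : ℤ_[p]) : ℚ_[p]) = rising (z : ℚ_[p]) k := by
  induction k with
  | zero => simp
  | succ k ih => rw [rising_succ, rising_succ, ← ih]; push_cast; rfl

lemma lt_norm_rising_of_not_dvd {α β : ℤ_[p]} {k : ℕ}
    (h : ¬ ((p : ℤ_[p]) ^ 2 ∣ (ascPochhammer ℤ_[p] k).eval (α - β + 1))) :
    (p : ℝ) ^ (-2 : ℤ) < ‖rising (1 + (α : ℚ_[p]) - β) k‖ := by
  rw [eval_ascPochhammer_eq_rising, ← Ideal.mem_span_singleton,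
    ← PadicInt.norm_le_pow_iff_mem_span_pow, not_le, PadicInt.norm_def, coe_rising] at h
  rw [show 1 + (α : ℚ_[p]) - β = ((α - β + 1 : ℤ_[p]) : ℚ_[p]) by push_cast; ring]
  exact_mod_cast h

end Padic

end VeryWellPoised

/-- Vanishing case of the p-adic Whipple `₇F₆` transformation:
the truncated very-well-poised `₇F₆` series is `≡ 0 (mod p²)`. -/
theorem padic_7F6_vanishing
    (p : ℕ) [Fact p.Prime] (hp : Odd p) (α β γ δ ε : ℤ_[p]) (hα : α ≠ 0)
    (h1a : res p (-α) ≤ res p (-β)) (h1b : res p (-α) ≤ res p (-γ))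
    (h1c : res p (-α) ≤ res p (-δ)) (h1d : res p (-α) ≤ res p (-ε))
    (h2a : p + res p (-α) > res p (-β) + res p (-γ))
    (h2b : p + res p (-α) > res p (-β) + res p (-δ))
    (h2c : p + res p (-α) > res p (-β) + res p (-ε))
    (h2d : p + res p (-α) > res p (-γ) + res p (-δ))
    (h3 : 2 * p - 1 + res p (-α) ≤ res p (-β) + res p (-γ) + res p (-δ) + res p (-ε))
    (h4a : ¬ ((p : ℤ_[p]) ^ 2 ∣ (ascPochhammer ℤ_[p] (p - 1)).eval (α - β + 1)))
    (h4b : ¬ ((p : ℤ_[p]) ^ 2 ∣ (ascPochhammer ℤ_[p] (p - 1)).eval (α - γ + 1)))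
    (h4c : ¬ ((p : ℤ_[p]) ^ 2 ∣ (ascPochhammer ℤ_[p] (p - 1)).eval (α - δ + 1)))
    (h4d : ¬ ((p : ℤ_[p]) ^ 2 ∣ (ascPochhammer ℤ_[p] (p - 1)).eval (α - ε + 1))) :
    ‖∑ k ∈ Finset.range p,
        (((α : ℚ_[p]) + 2 * k) / (α : ℚ_[p])) *
          (poch p (α : ℚ_[p]) k ^ 2 * poch p (β : ℚ_[p]) k * poch p (γ : ℚ_[p]) k
            * poch p (δ : ℚ_[p]) k * poch p (ε : ℚ_[p]) k)
          / ((Nat.factorial k : ℚ_[p]) ^ 2 * poch p ((α : ℚ_[p]) - (β : ℚ_[p]) + 1) k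
              * poch p ((α : ℚ_[p]) - (γ : ℚ_[p]) + 1) k
              * poch p ((α : ℚ_[p]) - (δ : ℚ_[p]) + 1) k
              * poch p ((α : ℚ_[p]) - (ε : ℚ_[p]) + 1) k)‖
      ≤ (p : ℝ) ^ (-2 : ℤ) := by
  have ha := VeryWellPoised.norm_add_res_lt_one α
  have hb := VeryWellPoised.norm_add_res_lt_one β
  have hc := VeryWellPoised.norm_add_res_lt_one γ
  have hd := VeryWellPoised.norm_add_res_lt_one δ
  have he := VeryWellPoised.norm_add_res_lt_one ε
  have lt (z : ℤ_[p]) : res p z < p := ZMod.val_lt _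
  have hap := lt (-α)
  have hbp := lt (-β)
  have hcp := lt (-γ)
  have hdp := lt (-δ)
  have hep := lt (-ε)
  have hnorm : ‖(α : ℚ_[p])‖ = 1 := by
    simpa using VeryWellPoised.norm_add_natCast_eq_one ha (i := 0)
      (VeryWellPoised.not_dvd_of_abs_lt (by omega) (by omega) (by omega))
  have hterm : ∀ k ∈ Finset.range p,
      (((α : ℚ_[p]) + 2 * k) / (α : ℚ_[p])) *
          (poch p (α : ℚ_[p]) k ^ 2 * poch p (β : ℚ_[p]) k * poch p (γ : ℚ_[p]) k
            * poch p (δ : ℚ_[p]) k * poch p (ε : ℚ_[p]) k)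
          / ((Nat.factorial k : ℚ_[p]) ^ 2 * poch p ((α : ℚ_[p]) - (β : ℚ_[p]) + 1) k
              * poch p ((α : ℚ_[p]) - (γ : ℚ_[p]) + 1) k
              * poch p ((α : ℚ_[p]) - (δ : ℚ_[p]) + 1) k
              * poch p ((α : ℚ_[p]) - (ε : ℚ_[p]) + 1) k) =
        VeryWellPoised.wellPoisedTerm (α : ℚ_[p]) β γ δ ε α k / α := by
    intro k _
    simp only [poch, VeryWellPoised.eval_ascPochhammer_eq_rising, VeryWellPoised.wellPoisedTerm,
      add_sub_cancel_right, VeryWellPoised.rising_one_eq_factorial, sub_add_eq_add_sub,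
      add_comm (α : ℚ_[p]) 1]
    simp only [div_eq_mul_inv, mul_inv]
    ring
  rw [Finset.sum_congr rfl hterm, ← Finset.sum_div, norm_div, hnorm, div_one,
    ← Finset.sum_range_add_sum_Ico _ (Nat.succ_le_of_lt hap)]
  refine (Padic.nonarchimedean _ _).trans (max_le ?_ ?_)
  · exact VeryWellPoised.norm_sum_wellPoisedTerm_head_le ha hb hc hd he h1a h1b h1c h1d
      hbp hcp hdp hep h2c h2d (by omega)
  · refine IsUltrametricDist.norm_sum_le_of_forall_le_of_nonneg (by positivity) fun k hk => ?_
    rw [Finset.mem_Ico] at hk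
    exact VeryWellPoised.norm_wellPoisedTerm_le_of_lt ha hb hc hd he h1a h1b h1c h1d
      hbp hcp hdp hep h2c h2d
      (VeryWellPoised.lt_norm_rising_of_not_dvd h4a) (VeryWellPoised.lt_norm_rising_of_not_dvd h4b)
      (VeryWellPoised.lt_norm_rising_of_not_dvd h4c) (VeryWellPoised.lt_norm_rising_of_not_dvd h4d)
      hk.1 hk.2
end
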